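/- Let a = (α,m) be an affine root and let f : V → ℂ be continuous. Then f(s_a(v)) = −f(v) for all v ∈ V if and only if ∫₀^{α(v)+m} f(v − tα∨) dt = 0 for all v ∈ V. -/

import Mathlib

open scoped BigOperators
open RealInnerProductSpace

noncomputable section

/-- The coroot `α∨` of a root `α`, under the identification of `V*` with `V`
via the inner product: `ξ(α∨) = 2⟨ξ,α⟩/‖α‖²`. -/
def coroot {V : Type*} [NormedAddCommGroup V] [InnerProductSpace ℝ V] (α : V) : V :=
  (2 / ‖α‖ ^ 2) • α

/-- The orthogonal reflection `s_α` in the hyperplane orthogonal to `α`: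
`s_α(ξ) = ξ − ξ(α∨)·α = ξ − α(ξ)·α∨`. -/
def sRefl {V : Type*} [NormedAddCommGroup V] [InnerProductSpace ℝ V] (α v : V) : V :=
  v - ⟪α, v⟫ • coroot α

/-- A finite, irreducible, reduced, crystallographic root system `Σ₀` in the dual of
the Euclidean space `V` (identified with `V` via the inner product), together with a
fixed base of simple roots, the positive roots, and the highest root. -/
structure RootSystemBase (V : Type*) [NormedAddCommGroup V] [InnerProductSpace ℝ V]
    [FiniteDimensional ℝ V] where
  roots : Finset V
  roots_nonempty : roots.Nonempty
  ne_zero : ∀ α ∈ roots, α ≠ (0 : V)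
  /-- reduced -/
  reduced : ∀ α ∈ roots, ∀ c : ℝ, c • α ∈ roots → c = 1 ∨ c = -1
  /-- crystallographic: `β(α∨) ∈ ℤ` -/
  crystallographic : ∀ α ∈ roots, ∀ β ∈ roots, ∃ m : ℤ, ⟪β, coroot α⟫ = (m : ℝ)
  /-- stable under the reflections `s_α` -/
  refl_mem : ∀ α ∈ roots, ∀ β ∈ roots, sRefl α β ∈ roots
  /-- `Σ₀` spans `V*` -/
  spanning : Submodule.span ℝ (roots : Set V) = ⊤
  /-- irreducible: no nontrivial orthogonal decomposition -/
  irreducible : ∀ s : Finset V, s ⊆ roots →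
    (∀ α ∈ s, ∀ β ∈ roots, β ∉ s → ⟪α, β⟫ = 0) → s = ∅ ∨ s = roots
  /-- the fixed base of simple roots -/
  simples : Finset V
  simples_sub : simples ⊆ roots
  simples_indep : LinearIndependent ℝ (fun β : {x // x ∈ simples} => (β : V))
  /-- the positive roots w.r.t. the base -/
  pos : Finset V
  pos_sub : pos ⊆ roots
  simples_sub_pos : simples ⊆ pos
  pos_or_neg : ∀ α ∈ roots, (α ∈ pos ∧ -α ∉ pos) ∨ (α ∉ pos ∧ -α ∈ pos)
  pos_combo : ∀ α ∈ pos, ∃ c : V → ℝ, (∀ β, 0 ≤ c β) ∧ α = ∑ β ∈ simples, c β • β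
  /-- the highest root `φ` -/
  hroot : V
  hroot_pos : hroot ∈ pos
  hroot_highest : ∀ α ∈ roots, ∃ c : V → ℝ, (∀ β, 0 ≤ c β) ∧
    hroot - α = ∑ β ∈ simples, c β • β

variable {V : Type*} [NormedAddCommGroup V] [InnerProductSpace ℝ V] [FiniteDimensional ℝ V]

/-- The Weyl group `W₀`: the subgroup of linear automorphisms of `V` generated by the
orthogonal reflections in the roots. -/
def weylGroup (R : RootSystemBase V) : Subgroup (V ≃ₗ[ℝ] V) :=
  Subgroup.closure {w : V ≃ₗ[ℝ] V | ∃ α ∈ R.roots, ∀ v, w v = sRefl α v}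

/-- A strictly positive `W₀`-invariant multiplicity function. -/
def IsMultiplicity (R : RootSystemBase V) (k : V → ℝ) : Prop :=
  (∀ α ∈ R.roots, 0 < k α) ∧
  (∀ w : V ≃ₗ[ℝ] V, w ∈ weylGroup R → ∀ α ∈ R.roots, k (w α) = k α)

/-- `σ_η^k = Σ_{α∈Σ₀} arctan(η(α∨)/k_α)·α`. -/
def sigmaFun (R : RootSystemBase V) (k : V → ℝ) (η : V) : V :=
  ∑ α ∈ R.roots, Real.arctan (⟪η, coroot α⟫ / k α) • α

/-- The master function
`S_k(μ,ξ) = ½‖ξ‖² − 2π⟨μ,ξ⟩ + ½ Σ_{α∈Σ₀} ‖α‖² ∫₀^{ξ(α∨)} arctan(t/k_α) dt`. -/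
def masterFun (R : RootSystemBase V) (k : V → ℝ) (μ ξ : V) : ℝ :=
  ‖ξ‖ ^ 2 / 2 - 2 * Real.pi * ⟪μ, ξ⟫ +
    (1 / 2) * ∑ α ∈ R.roots, ‖α‖ ^ 2 * ∫ t in (0:ℝ)..(⟪ξ, coroot α⟫), Real.arctan (t / k α)

/-- Membership in the weight lattice `P = {λ ∈ V* : λ(α∨) ∈ ℤ ∀α ∈ Σ₀}`. -/
def IsWeight (R : RootSystemBase V) (lam : V) : Prop :=
  ∀ α ∈ R.roots, ∃ m : ℤ, ⟪lam, coroot α⟫ = (m : ℝ)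

/-- `η ∈ V*` is a Bethe root: `λ = iη` solves the Bethe ansatz equations
`e^{(wλ)(φ∨)} = ∏_{α∈Σ₀⁺} ((wλ)(α∨) − k_α)/((wλ)(α∨) + k_α))^{α(φ∨)}` for all `w ∈ W₀`,
where `m α = α(φ∨) ∈ ℤ≥0`. -/
def IsBetheRoot (R : RootSystemBase V) (k : V → ℝ) (m : V → ℕ) (η : V) : Prop :=
  ∀ w : V ≃ₗ[ℝ] V, w ∈ weylGroup R →
    Complex.exp (Complex.I * (⟪w η, coroot R.hroot⟫ : ℝ)) =
      ∏ α ∈ R.pos,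
        ((Complex.I * (⟪w η, coroot α⟫ : ℝ) - (k α : ℂ)) /
         (Complex.I * (⟪w η, coroot α⟫ : ℝ) + (k α : ℂ))) ^ (m α)

end

noncomputable section

theorem inner_coroot_self {V : Type*} [NormedAddCommGroup V] [InnerProductSpace ℝ V]
    {α : V} (hα : α ≠ 0) : ⟪α, coroot α⟫ = 2 := by
  rw [coroot, inner_smul_right, real_inner_self_eq_norm_sq]
  have := norm_ne_zero_iff.mpr hα
  field_simp

/-- A function that is antisymmetric under `t ↦ c - t` has integral zero over `[0, c]`. -/
theorem intervalIntegral_eq_zero_of_antisymm {g : ℝ → ℂ} {c : ℝ}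
    (h : ∀ t, g (c - t) = -g t) : ∫ t in (0 : ℝ)..c, g t = 0 := by
  have key := intervalIntegral.integral_comp_sub_left (a := 0) (b := c) g c
  simp only [h, intervalIntegral.integral_neg, sub_self, sub_zero] at key
  exact self_eq_neg.mp key.symm

/-- If the integrals of `g` over all intervals with midpoint `c / 2` vanish, then
`g c = -g 0`. -/
theorem eq_neg_of_intervalIntegral_eq_zero {g : ℝ → ℂ} (hg : Continuous g) {c : ℝ}
    (h : ∀ r : ℝ, ∫ t in (-r)..(c + r), g t = 0) : g c = -g 0 := by
  have hF (x : ℝ) : HasDerivAt (fun y => ∫ t in (0 : ℝ)..y, g t) (g x) x :=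
    hg.integral_hasStrictDerivAt 0 x |>.hasDerivAt
  have h₁ := HasDerivAt.comp_const_add c 0 (hF (c + 0))
  have h₂ := HasDerivAt.scomp (0 : ℝ) (hF (-0)) (hasDerivAt_neg (0 : ℝ))
  have h₃ := (h₁.sub h₂).unique ((hasDerivAt_const (0 : ℝ) (0 : ℂ)).congr_of_eventuallyEq
    (Filter.Eventually.of_forall fun r => by
      simpa [intervalIntegral.integral_interval_sub_left (hg.intervalIntegrable _ _)
        (hg.intervalIntegrable _ _)] using h r))
  simp only [add_zero, neg_zero, neg_smul, one_smul, sub_neg_eq_add] at h₃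
  exact eq_neg_of_add_eq_zero_left h₃

/-- For an affine root `a = (α,m)` and continuous `f : V → ℂ`:
`f(s_a(v)) = −f(v)` for all `v` iff `∫₀^{α(v)+m} f(v − tα∨) dt = 0` for all `v`. -/
theorem statement12
    {V : Type*} [NormedAddCommGroup V] [InnerProductSpace ℝ V] [FiniteDimensional ℝ V]
    (R : RootSystemBase V)
    (α : V) (hα : α ∈ R.roots) (mm : ℤ) (f : V → ℂ) (hf : Continuous f) :
    (∀ v : V, f (v - (⟪α, v⟫ + (mm : ℝ)) • coroot α) = - f v) ↔
    (∀ v : V, (∫ t in (0:ℝ)..(⟪α, v⟫ + (mm : ℝ)), f (v - t • coroot α)) = 0) := by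
  have h2 := inner_coroot_self (R.ne_zero α hα)
  constructor
  · intro h v
    apply intervalIntegral_eq_zero_of_antisymm
    intro t
    rw [← h (v - t • coroot α), inner_sub_right, inner_smul_right, h2]
    congr 1
    module
  · intro h v
    have hg : Continuous fun t : ℝ => f (v - t • coroot α) := by fun_prop
    have := eq_neg_of_intervalIntegral_eq_zero hg (c := ⟪α, v⟫ + (mm : ℝ)) fun r => by
      have hr := h (v + r • coroot α)
      rw [inner_add_right, inner_smul_right, h2] at hr
      have hs := intervalIntegral.integral_comp_sub_right
        (a := 0) (b := ⟪α, v⟫ + r * 2 + mm) (fun t : ℝ => f (v - t • coroot α)) r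
      rw [zero_sub, show ⟪α, v⟫ + r * 2 + mm - r = ⟪α, v⟫ + mm + r by ring] at hs
      rw [← hs, ← hr]
      congr 1 with t
      congr 1
      module
    simpa using this

end
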